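/- For every a ∈ ℚ with a ∉ {0, −1, −2}, the cubic polynomial (a+1)X³ − (a+1)X² + aX + 1 ∈ ℚ[X] does not split into linear factors over ℚ; that is, there do not exist r, s, t ∈ ℚ with (a+1)X³ − (a+1)X² + aX + 1 = (a+1)(X − r)(X − s)(X − t). Equivalently, a quadratic rational map over ℚ with a rational critical 3-cycle has at most one rational fixed point. -/

import Mathlib

/-- Eisenstein integers. -/
abbrev Eis := QuadraticAlgebra ℤ (-1) (-1)

namespace Eis
open QuadraticAlgebra

theorem nrm (z : Eis) : norm z = z.re ^ 2 - z.re * z.im + z.im ^ 2 := by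
  rw [norm_def]; ring

theorem nrm_nonneg (z : Eis) : 0 ≤ norm z := by
  rw [nrm]; nlinarith [sq_nonneg (2 * z.re - z.im), sq_nonneg z.im]

theorem nrm_pos {z : Eis} (hz : z ≠ 0) : 0 < norm z := by
  rcases (nrm_nonneg z).lt_or_eq with h | h
  · exact h
  · exfalso
    apply hz
    rw [nrm] at h
    have h2 : z.im ^ 2 = 0 := by nlinarith [sq_nonneg (2 * z.re - z.im), sq_nonneg z.im]
    have h3 : z.im = 0 := by simpa using h2
    rw [h3] at h
    have h4 : z.re = 0 := by simpa using h.symm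
    ext <;> simp [h3, h4]

theorem round_exists (u N : ℤ) (hN : 0 < N) : ∃ q : ℤ, 4 * (u - q * N) ^ 2 ≤ N ^ 2 := by
  refine ⟨(2 * u + N) / (2 * N), ?_⟩
  have h1 := Int.emod_nonneg (2 * u + N) (b := 2 * N) (by omega)
  have h2 := Int.emod_lt_of_pos (2 * u + N) (b := 2 * N) (by omega)
  have h3 := Int.mul_ediv_add_emod (2 * u + N) (2 * N)
  set q := (2 * u + N) / (2 * N)
  have h4 : -N ≤ 2 * (u - q * N) := by nlinarith
  have h5 : 2 * (u - q * N) ≤ N := by nlinarith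
  nlinarith [abs_le.mpr ⟨h4, h5⟩, sq_le_sq' h4 h5]

theorem div_exists (x y : Eis) : ∃ q : Eis, (y = 0 → q = 0) ∧
    (y ≠ 0 → norm (x - y * q) < norm y) := by
  by_cases hy : y = 0
  · exact ⟨0, fun _ => rfl, fun h => absurd hy h⟩
  have hN := nrm_pos hy
  obtain ⟨q1, h1⟩ := round_exists (x * star y).re _ hN
  obtain ⟨q2, h2⟩ := round_exists (x * star y).im _ hN
  refine ⟨⟨q1, q2⟩, fun h => absurd h hy, fun _ => ?_⟩
  set e := (x * star y).re - q1 * norm y with he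
  set f := (x * star y).im - q2 * norm y with hf
  have key : norm (x - y * ⟨q1, q2⟩) * norm y = e ^ 2 - e * f + f ^ 2 := by
    rw [he, hf]
    simp only [nrm, re_sub, im_sub, re_mul, im_mul, re_star, im_star]
    ring
  have h3 : e ^ 2 - e * f + f ^ 2 < norm y * norm y := by
    nlinarith [sq_nonneg (e + f)]
  exact lt_of_mul_lt_mul_right (by rw [key]; exact h3) hN.le

noncomputable instance : EuclideanDomain Eis :=
  { (inferInstance : CommRing Eis), (inferInstance : Nontrivial Eis) with
    quotient := fun x y => Classical.choose (div_exists x y)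
    remainder := fun x y => x - y * Classical.choose (div_exists x y)
    quotient_zero := fun x => (Classical.choose_spec (div_exists x 0)).1 rfl
    quotient_mul_add_remainder_eq := fun x y => by ring
    r := fun x y => (norm x).natAbs < (norm y).natAbs
    r_wellFounded := (measure (fun z : Eis => (norm z).natAbs)).wf
    remainder_lt := fun x y hy => by
      have h := (Classical.choose_spec (div_exists x y)).2 hy
      have := nrm_nonneg (x - y * Classical.choose (div_exists x y))
      omega
    mul_left_not_lt := fun x y hy => by
      rw [map_mul, Int.natAbs_mul, not_lt]
      have := nrm_pos hy
      exact Nat.le_mul_of_pos_right _ (by omega) }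

theorem unit_cases (a b : ℤ) (h : a ^ 2 - a * b + b ^ 2 = 1) :
    (a = 1 ∧ b = 0) ∨ (a = -1 ∧ b = 0) ∨ (a = 0 ∧ b = 1) ∨ (a = 0 ∧ b = -1) ∨
    (a = 1 ∧ b = 1) ∨ (a = -1 ∧ b = -1) := by
  have hb1 : b ≤ 1 := by nlinarith [sq_nonneg (2 * a - b)]
  have hb2 : -1 ≤ b := by nlinarith [sq_nonneg (2 * a - b)]
  have ha1 : a ≤ 1 := by nlinarith [sq_nonneg (2 * b - a)]
  have ha2 : -1 ≤ a := by nlinarith [sq_nonneg (2 * b - a)]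
  interval_cases a <;> interval_cases b <;> simp_all

theorem cube_lemma (p q c : ℤ) (h : p ^ 2 - p * q + q ^ 2 = c ^ 3) (hq : 3 ∣ q)
    (hco : IsCoprime (p ^ 2 - p * q + q ^ 2) (2 * p - q)) :
    ∃ m n : ℤ, p = m ^ 3 + n ^ 3 - 3 * m * n ^ 2 ∧ q = 3 * (m * n * (m - n)) ∧
      c = m ^ 2 - m * n + n ^ 2 := by
  have hp : ¬ 3 ∣ p := by
    rintro ⟨p', rfl⟩
    obtain ⟨q', rfl⟩ := hq
    obtain ⟨u, v, huv⟩ := hco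
    have : (3 : ℤ) * (u * (3 * (p' ^ 2 - p' * q' + q' ^ 2)) + v * (2 * p' - q')) = 1 := by
      rw [← huv]; ring
    omega
  let β : Eis := ⟨p, q⟩
  have hs : β * star β = ((c : ℤ) : Eis) ^ 3 := by
    rw [← Int.cast_pow, ← h]
    ext
    · rw [re_intCast]; simp [β]; ring
    · rw [im_intCast]; simp [β]; ring
  have hc : IsCoprime β (star β) := by
    obtain ⟨u, v, huv⟩ := hco
    refine ⟨(u : Eis) * star β + v, v, ?_⟩
    have e1 : (u : Eis) * (β * star β) + v * (β + star β) = 1 := by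
      have := congrArg (Int.cast : ℤ → Eis) huv
      ext
      · simp [β]; linarith
      · simp [β]; ring_nf; simp
    rw [← e1]; ring
  obtain ⟨d, w, hw⟩ := exists_associated_pow_of_mul_eq_pow' hc hs
  have hwn : IsUnit (norm (w : Eis)) := isUnit_iff_norm_isUnit.mp w.isUnit
  have hw1 : norm (w : Eis) = 1 := by
    have := nrm_nonneg (w : Eis)
    rcases Int.isUnit_iff.mp hwn with h | h <;> omega
  rw [nrm] at hw1
  obtain ⟨m, n⟩ := d
  have hre := congrArg QuadraticAlgebra.re hw
  have him := congrArg QuadraticAlgebra.im hw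
  have hre' : p = (m ^ 3 + n ^ 3 - 3 * m * n ^ 2) * (w : Eis).re
      - 3 * (m * n * (m - n)) * (w : Eis).im := by
    have : β.re = p := rfl
    rw [← this, ← hre]; simp [pow_succ]; ring
  have him' : q = (m ^ 3 + n ^ 3 - 3 * m * n ^ 2) * (w : Eis).im
      + 3 * (m * n * (m - n)) * ((w : Eis).re - (w : Eis).im) := by
    have : β.im = q := rfl
    rw [← this, ← him]; simp [pow_succ]; ring
  have fin : ∀ m n : ℤ, p = m ^ 3 + n ^ 3 - 3 * m * n ^ 2 → q = 3 * (m * n * (m - n)) →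
      c = m ^ 2 - m * n + n ^ 2 := by
    intro m n h1 h2
    have : c ^ 3 = (m ^ 2 - m * n + n ^ 2) ^ 3 := by rw [← h, h1, h2]; ring
    exact (Odd.strictMono_pow (by decide : Odd 3)).injective this
  generalize (w : Eis).re = a at *
  generalize (w : Eis).im = b at *
  set A := m ^ 3 + n ^ 3 - 3 * m * n ^ 2 with hA
  set B := m * n * (m - n) with hB
  rcases unit_cases a b hw1 with ⟨rfl, rfl⟩ | ⟨rfl, rfl⟩ | ⟨rfl, rfl⟩ | ⟨rfl, rfl⟩ |
    ⟨rfl, rfl⟩ | ⟨rfl, rfl⟩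
  · have h1 : p = m ^ 3 + n ^ 3 - 3 * m * n ^ 2 := by linarith
    have h2 : q = 3 * (m * n * (m - n)) := by linarith
    exact ⟨m, n, h1, h2, fin m n h1 h2⟩
  · have h1 : p = (-m) ^ 3 + (-n) ^ 3 - 3 * (-m) * (-n) ^ 2 := by
      rw [hre', hA]; ring
    have h2 : q = 3 * ((-m) * (-n) * ((-m) - (-n))) := by rw [him', hB]; ring
    exact ⟨-m, -n, h1, h2, fin _ _ h1 h2⟩
  all_goals (exfalso; omega)

end Eis

/-- From `a + b + c = 2 d`, `a b c = d ^ 3` to the Hesse cubic. -/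
theorem to_hesse (a b c d : ℤ) (hd : d ≠ 0) (hs : a + b + c = 2 * d) (hp : a * b * c = d ^ 3) :
    ∃ X Y Z : ℤ, IsCoprime X Y ∧ IsCoprime Y Z ∧ IsCoprime Z X ∧ X ≠ 0 ∧ Y ≠ 0 ∧ Z ≠ 0 ∧
      X ^ 3 + Y ^ 3 + Z ^ 3 = 2 * (X * Y * Z) ∧ |X * Y * Z| ≤ |d| := by
  -- common factor
  have habc : a * b * c ≠ 0 := by rw [hp]; exact pow_ne_zero _ hd
  have ha : a ≠ 0 := by rintro rfl; simp at habc
  have hb : b ≠ 0 := by rintro rfl; simp at habc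
  have hc : c ≠ 0 := by rintro rfl; simp at habc
  obtain ⟨g, hg0, hga, hgb, hgc, hgcd⟩ : ∃ g : ℤ, g ≠ 0 ∧ g ∣ a ∧ g ∣ b ∧ g ∣ c ∧
      ∀ r : ℤ, r * g ∣ a → r * g ∣ b → r * g ∣ c → IsUnit r := by
    refine ⟨gcd a (gcd b c), ?_, gcd_dvd_left _ _, (gcd_dvd_right _ _).trans (gcd_dvd_left _ _),
      (gcd_dvd_right _ _).trans (gcd_dvd_right _ _), ?_⟩
    · intro h; exact ha ((gcd_eq_zero_iff _ _).mp h).1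
    · intro r h1 h2 h3
      have h4 := dvd_gcd h1 (dvd_gcd h2 h3)
      have h5 : gcd a (gcd b c) ≠ 0 := by
        intro h; exact ha ((gcd_eq_zero_iff _ _).mp h).1
      obtain ⟨k, hk⟩ := h4
      have : r * k = 1 := by
        apply mul_left_cancel₀ h5
        linear_combination -hk
      exact IsUnit.of_mul_eq_one _ this
  obtain ⟨a, rfl⟩ := hga
  obtain ⟨b, rfl⟩ := hgb
  obtain ⟨c, rfl⟩ := hgc
  have hgd : g ∣ d := by
    have : g ^ 3 ∣ d ^ 3 := ⟨a * b * c, by rw [← hp]; ring⟩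
    exact (Int.pow_dvd_pow_iff (by norm_num)).mp this
  obtain ⟨d, rfl⟩ := hgd
  have hs' : a + b + c = 2 * d := mul_left_cancel₀ hg0 (by linear_combination hs)
  have hp' : a * b * c = d ^ 3 :=
    mul_left_cancel₀ (pow_ne_zero 3 hg0) (by linear_combination hp)
  have ha := right_ne_zero_of_mul ha
  have hb := right_ne_zero_of_mul hb
  have hc := right_ne_zero_of_mul hc
  have hd' := right_ne_zero_of_mul hd
  have hno : ∀ r : ℤ, Prime r → r ∣ a → r ∣ b → r ∣ c → False := by
    intro r hr h1 h2 h3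
    refine hr.not_isUnit (hgcd r ?_ ?_ ?_) <;> rw [mul_comm r g] <;>
      exact mul_dvd_mul_left g (by assumption)
  have hrd : ∀ r : ℤ, Prime r → r ∣ a * b * c → r ∣ a + b + c := by
    intro r hr h
    rw [hs']
    rw [hp'] at h
    exact (hr.dvd_of_dvd_pow h).mul_left 2
  have cab : IsCoprime a b := isCoprime_of_prime_dvd (by tauto) (by
    intro r hr h1 h2
    have h3 := hrd r hr ((h1.mul_right b).mul_right c)
    exact hno r hr h1 h2 ((Int.dvd_add_right (dvd_add h1 h2)).mp h3))
  have cbc : IsCoprime b c := isCoprime_of_prime_dvd (by tauto) (by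
    intro r hr h1 h2
    have h3 := hrd r hr (h2.mul_left _)
    rw [add_assoc] at h3
    exact hno r hr ((Int.dvd_add_left (dvd_add h1 h2)).mp h3) h1 h2)
  have cca : IsCoprime c a := isCoprime_of_prime_dvd (by tauto) (by
    intro r hr h1 h2
    have h3 := hrd r hr (h1.mul_left _)
    rw [show a + b + c = (c + a) + b by ring] at h3
    exact hno r hr h2 ((Int.dvd_add_right (dvd_add h1 h2)).mp h3) h1)
  obtain ⟨X, hX⟩ := Int.eq_pow_of_mul_eq_pow_odd_left (k := 3) (cab.mul_right cca.symm)
    (by decide) (show a * (b * c) = d ^ 3 by linear_combination hp')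
  obtain ⟨Y, hY⟩ := Int.eq_pow_of_mul_eq_pow_odd_left (k := 3) (cbc.mul_right cab.symm)
    (by decide) (show b * (c * a) = d ^ 3 by linear_combination hp')
  obtain ⟨Z, hZ⟩ := Int.eq_pow_of_mul_eq_pow_odd_left (k := 3) (cca.mul_right cbc.symm)
    (by decide) (show c * (a * b) = d ^ 3 by linear_combination hp')
  subst hX hY hZ
  have hD : X * Y * Z = d := by
    have : (X * Y * Z) ^ 3 = d ^ 3 := by rw [← hp']; ring
    exact (Odd.strictMono_pow (by decide : Odd 3)).injective this
  refine ⟨X, Y, Z, ?_, ?_, ?_, ?_, ?_, ?_, ?_, ?_⟩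
  · exact (IsCoprime.pow_iff (by norm_num) (by norm_num)).mp cab
  · exact (IsCoprime.pow_iff (by norm_num) (by norm_num)).mp cbc
  · exact (IsCoprime.pow_iff (by norm_num) (by norm_num)).mp cca
  · rintro rfl; simp at ha
  · rintro rfl; simp at hb
  · rintro rfl; simp at hc
  · rw [hD]; exact hs'
  · rw [hD, abs_mul]
    have := Int.one_le_abs hg0
    nlinarith [abs_nonneg d]

/-- The second descent. -/
theorem descent_cubes (X Y Z : ℤ) (hXY : IsCoprime X Y) (hX : X ≠ 0)
    (h : X ^ 3 + Y ^ 3 + Z ^ 3 = 2 * (X * Y * Z)) (h19 : 19 ∣ 2 * X + 3 * Y + 3 * Z) :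
    ∃ e m n : ℤ, 2 * X + 3 * Y + 3 * Z = 19 * e ^ 3 ∧ X = -(e * (m ^ 2 - m * n + n ^ 2)) ∧
      2 * X - 3 * Z = m ^ 3 + n ^ 3 - 3 * m * n ^ 2 ∧ Y - Z = m * n * (m - n) := by
  have hno : ∀ r : ℤ, Prime r → r ∣ X → r ∣ Y → False := fun r hr h1 h2 =>
    hr.not_isUnit (hXY.isUnit_of_dvd' h1 h2)
  have p3 : Prime (3 : ℤ) := Int.prime_three
  by_cases h3 : (3 : ℤ) ∣ X
  · -- the case where 3 divides X
    have hY3 : ¬ (3 : ℤ) ∣ Y := fun h' => hno 3 p3 h3 h'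
    obtain ⟨x, rfl⟩ := h3
    have hYZ : (3 : ℤ) ∣ Y + Z := by
      have h1 : (3 : ℤ) ∣ (Y + Z) ^ 3 :=
        ⟨2 * x * Y * Z - 9 * x ^ 3 + Y ^ 2 * Z + Y * Z ^ 2, by linear_combination h⟩
      exact p3.dvd_of_dvd_pow h1
    obtain ⟨k, hk⟩ := hYZ
    obtain rfl : Z = 3 * k - Y := by linarith
    have hx : (3 : ℤ) ∣ x := by
      have h1 : (3 : ℤ) ∣ x * Y ^ 2 := by
        have : (9 : ℤ) * (3 * x ^ 3 + 3 * k ^ 3 - 3 * k ^ 2 * Y + k * Y ^ 2 -2 * x * Y * k)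
          = 3 * (-2 * (x * Y ^ 2)) := by
          linear_combination h
        omega
      rcases p3.dvd_or_dvd h1 with h2 | h2
      · exact h2
      · exact absurd (p3.dvd_of_dvd_pow h2) hY3
    obtain ⟨w, rfl⟩ := hx
    -- L = 2 X + 3 Y + 3 Z = 18 w + 9 k
    obtain ⟨j, hj⟩ := h19
    have hj9 : (9 : ℤ) ∣ j := by omega
    obtain ⟨M', rfl⟩ := hj9
    have hk' : k = 19 * M' - 2 * w := by linarith
    have hM3 : (3 : ℤ) ∣ M' := by
      subst hk'
      have h1 : (3 : ℤ) ∣ M' * Y ^ 2 := by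
        have e : 19 * (M' * Y ^ 2) = 3 * (-27 * w ^ 3 - (19 * M' - 2 * w) ^ 3
            + (19 * M' - 2 * w) ^ 2 * Y + 2 * w * Y * (19 * M' - 2 * w)) := by
          apply mul_left_cancel₀ (show (9 : ℤ) ≠ 0 by norm_num)
          linear_combination h
        omega
      rcases p3.dvd_or_dvd h1 with h2 | h2
      · exact h2
      · exact absurd (p3.dvd_of_dvd_pow h2) hY3
    obtain ⟨M, rfl⟩ := hM3
    subst hk'
    have hw : w ≠ 0 := by rintro rfl; simp at hX
    set p := Y - 57 * M with hp
    set q := 57 * M - 6 * w with hq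
    have hN : M * (p ^ 2 - p * q + q ^ 2) = (-w) ^ 3 := by
      rw [hp, hq]
      have : (27 * 19 * 27 : ℤ) ≠ 0 := by norm_num
      apply mul_left_cancel₀ this
      linear_combination 27 * h
    have hNw : ∀ r : ℤ, Prime r → r ∣ p ^ 2 - p * q + q ^ 2 → r ∣ w := fun r hr h1 => by
      have := hr.dvd_of_dvd_pow (hN ▸ h1.mul_left M)
      simpa using this
    have hpq0 : p ^ 2 - p * q + q ^ 2 ≠ 0 := by
      intro h0; rw [h0] at hN; exact pow_ne_zero 3 (neg_ne_zero.mpr hw) (by rw [← hN, mul_zero])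
    have c1 : IsCoprime M (p ^ 2 - p * q + q ^ 2) := isCoprime_of_prime_dvd (by tauto) (by
      intro r hr h1 h2
      have h4 := hNw r hr h2
      refine hno r hr ((h4.mul_left 3).mul_left 3) ?_
      obtain ⟨M1, rfl⟩ := h1
      obtain ⟨w1, rfl⟩ := h4
      obtain ⟨t, ht⟩ := h2
      refine hr.dvd_of_dvd_pow (n := 2) ?_
      rw [hp, hq] at ht
      exact ⟨t + 171 * M1 * Y - 6 * w1 * Y - r * (57 ^ 2 * 3 * M1 ^ 2 - 18 * 57 * M1 * w1 + 36 * w1 ^ 2),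
        by linear_combination ht⟩)
    have c2 : IsCoprime (p ^ 2 - p * q + q ^ 2) (2 * p - q) :=
      isCoprime_of_prime_dvd (by tauto) (by
      intro r hr h1 h2
      have h4 := hNw r hr h1
      have hrX : r ∣ 3 * (3 * w) := (h4.mul_left 3).mul_left 3
      have e : (3 : ℤ) * p ^ 2 = (p ^ 2 - p * q + q ^ 2) + (2 * p - q) * (p + q) := by ring
      have h5 : r ∣ 3 * p ^ 2 := by
        rw [e]; exact dvd_add h1 (h2.mul_right _)
      refine hno r hr hrX ?_
      rcases hr.dvd_or_dvd h5 with h6 | h6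
      · have e2 : Y = 3 * (Y - 57 * M + 2 * w) - (2 * p - q) := by rw [hp, hq]; ring
        rw [e2]; exact dvd_sub (h6.mul_right _) h2
      · have h7 := hr.dvd_of_dvd_pow h6
        have e2 : Y = p * 3 - (2 * p - q) + 6 * w := by rw [hp, hq]; ring
        rw [e2]; exact dvd_add (dvd_sub (h7.mul_right _) h2) (h4.mul_left _))
    obtain ⟨e, he⟩ := Int.eq_pow_of_mul_eq_pow_odd_left (k := 3) c1 (by decide) hN
    obtain ⟨c, hc⟩ := Int.eq_pow_of_mul_eq_pow_odd_right (k := 3) c1 (by decide) hN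
    obtain ⟨m, n, hm, hn, hcc⟩ := Eis.cube_lemma p q c hc ⟨19 * M - 2 * w, by rw [hq]; ring⟩ c2
    have hwe : w = -(e * c) := by
      have : (-w) ^ 3 = (e * c) ^ 3 := by rw [← hN, he, hc]; ring
      have := (Odd.strictMono_pow (by decide : Odd 3)).injective this
      linarith
    refine ⟨3 * e, 2 * n - m, n - 2 * m, ?_, ?_, ?_, ?_⟩
    · linear_combination 27 * 19 * he
    · linear_combination 9 * hwe - 9 * e * hcc
    · linear_combination 3 * hm - 6 * hn
    · linear_combination 2 * hm - hn
  · obtain ⟨M, hM⟩ := h19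
    set p := 2 * X - 3 * Z with hp
    set q := 3 * Y - 3 * Z with hq
    have hN : M * (p ^ 2 - p * q + q ^ 2) = (-X) ^ 3 := by
      have : (19 : ℤ) ≠ 0 := by norm_num
      apply mul_left_cancel₀ this
      rw [hp, hq]
      linear_combination 27 * h - (p ^ 2 - p * q + q ^ 2) * hM
    have hNw : ∀ r : ℤ, Prime r → r ∣ p ^ 2 - p * q + q ^ 2 → r ∣ X := fun r hr h1 => by
      have := hr.dvd_of_dvd_pow (hN ▸ h1.mul_left M)
      simpa using this
    have hpq0 : p ^ 2 - p * q + q ^ 2 ≠ 0 := by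
      intro h0; rw [h0] at hN; exact pow_ne_zero 3 (neg_ne_zero.mpr hX) (by rw [← hN, mul_zero])
    -- a prime dividing X, N and 3 (Y + Z) is impossible
    have hno2 : ∀ r : ℤ, Prime r → r ∣ p ^ 2 - p * q + q ^ 2 → r ∣ X → r ∣ 3 * (Y + Z) → False := by
      intro r hr h1 h2 h4
      refine hno r hr h2 ?_
      have e : (27 : ℤ) * Y ^ 2 = (p ^ 2 - p * q + q ^ 2) - X * (4 * X - 6 * Y - 6 * Z)
          - 3 * (Y + Z) * (3 * Z - 6 * Y) := by rw [hp, hq]; ring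
      have h5 : r ∣ 3 ^ 3 * Y ^ 2 := by
        norm_num
        rw [e]; exact dvd_sub (dvd_sub h1 (h2.mul_right _)) (h4.mul_right _)
      rcases hr.dvd_or_dvd h5 with h6 | h6
      · exfalso
        have h7 := hr.dvd_of_dvd_pow h6
        have h8 : Associated r 3 := hr.associated_of_dvd p3 h7
        exact h3 (h8.symm.dvd.trans h2)
      · exact hr.dvd_of_dvd_pow h6
    have c1 : IsCoprime M (p ^ 2 - p * q + q ^ 2) := isCoprime_of_prime_dvd (by tauto) (by
      intro r hr h1 h2
      have h4 := hNw r hr h2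
      refine hno2 r hr h2 h4 ?_
      rw [show 3 * (Y + Z) = 19 * M - 2 * X by linarith]
      exact dvd_sub (h1.mul_left _) (h4.mul_left _))
    have c2 : IsCoprime (p ^ 2 - p * q + q ^ 2) (2 * p - q) :=
      isCoprime_of_prime_dvd (by tauto) (by
      intro r hr h1 h2
      have h4 := hNw r hr h1
      refine hno2 r hr h1 h4 ?_
      rw [show 3 * (Y + Z) = 4 * X - (2 * p - q) by rw [hp, hq]; ring]
      exact dvd_sub (h4.mul_left _) h2)
    obtain ⟨e, he⟩ := Int.eq_pow_of_mul_eq_pow_odd_left (k := 3) c1 (by decide) hN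
    obtain ⟨c, hc⟩ := Int.eq_pow_of_mul_eq_pow_odd_right (k := 3) c1 (by decide) hN
    obtain ⟨m, n, hm, hn, hcc⟩ := Eis.cube_lemma p q c hc ⟨Y - Z, by rw [hq]; ring⟩ c2
    have hXe : X = -(e * c) := by
      have : (-X) ^ 3 = (e * c) ^ 3 := by rw [← hN, he, hc]; ring
      have := (Odd.strictMono_pow (by decide : Odd 3)).injective this
      linarith
    exact ⟨e, m, n, by rw [hM, he], by rw [← hcc]; exact hXe, hm, by linarith⟩

theorem descent_step (X Y Z : ℤ) (hXY : IsCoprime X Y) (hX : X ≠ 0) (hY : Y ≠ 0) (hZ : Z ≠ 0)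
    (h : X ^ 3 + Y ^ 3 + Z ^ 3 = 2 * (X * Y * Z)) (h19 : 19 ∣ 2 * X + 3 * Y + 3 * Z) :
    ∃ a b c d : ℤ, d ≠ 0 ∧ a + b + c = 2 * d ∧ a * b * c = d ^ 3 ∧ |d| < |X * Y * Z| := by
  obtain ⟨e, m, n, h1, h2, h3, h4⟩ := descent_cubes X Y Z hXY hX h h19
  have he : e ≠ 0 := by rintro rfl; simp at h2; exact hX h2
  have key : (m + n + 2 * e) * (m - 2 * n + 2 * e) * (n - 2 * m + 2 * e) = 27 * e ^ 3 := by
    linear_combination h1 - 6 * h2 + 2 * h3 - 3 * h4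
  have h3a : (3 : ℤ) ∣ m + n + 2 * e := by
    have p3 : Prime (3 : ℤ) := Int.prime_three
    have : (3 : ℤ) ∣ (m + n + 2 * e) * (m - 2 * n + 2 * e) * (n - 2 * m + 2 * e) :=
      ⟨9 * e ^ 3, by rw [key]; ring⟩
    rcases p3.dvd_or_dvd this with h | h
    · rcases p3.dvd_or_dvd h with h | h <;> omega
    · omega
  obtain ⟨a, ha⟩ := h3a
  refine ⟨a, a - n, a - m, e, he, by linarith, ?_, ?_⟩
  · have e1 : m - 2 * n + 2 * e = 3 * (a - n) := by linarith
    have e2 : n - 2 * m + 2 * e = 3 * (a - m) := by linarith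
    rw [ha, e1, e2] at key
    linarith
  · have hX1 : |e| ≤ |X| := by
      have hN : m ^ 2 - m * n + n ^ 2 ≠ 0 := by
        intro h0; rw [h0] at h2; simp at h2; exact hX h2
      rw [h2, abs_neg, abs_mul]
      have := Int.one_le_abs hN
      nlinarith [abs_nonneg e]
    have hYZ : 1 < |Y * Z| := by
      by_contra hcon
      have h5 : |Y * Z| = 1 := by
        have := Int.one_le_abs (mul_ne_zero hY hZ); omega
      have h6 : IsUnit (Y * Z) := Int.isUnit_iff_abs_eq.mpr h5
      have hYu := Int.isUnit_iff.mp (isUnit_of_mul_isUnit_left h6)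
      have hZu := Int.isUnit_iff.mp (isUnit_of_mul_isUnit_right h6)
      have no1 : X ^ 3 + 2 ≠ 2 * X := by
        intro h
        have : X ∣ 2 := ⟨2 - X ^ 2, by linarith⟩
        have l1 := Int.le_of_dvd (by norm_num) this
        have l2 := Int.le_of_dvd (by norm_num) ((neg_dvd).mpr this)
        have l3 : -2 ≤ X := by linarith
        interval_cases X <;> omega
      have no2 : X ^ 3 - 2 ≠ 2 * X := by
        intro h
        have : X ∣ 2 := ⟨X ^ 2 - 2, by linarith⟩
        have l1 := Int.le_of_dvd (by norm_num) this
        have l2 := Int.le_of_dvd (by norm_num) ((neg_dvd).mpr this)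
        have l3 : -2 ≤ X := by linarith
        interval_cases X <;> omega
      have no3 : X ^ 3 ≠ - 2 * X := by
        intro h
        have : X ^ 2 = -2 := mul_left_cancel₀ hX (by linarith)
        nlinarith
      rcases hYu with rfl | rfl <;> rcases hZu with rfl | rfl
      · apply no1; linarith
      · apply no3; linarith
      · apply no3; linarith
      · apply no2; linarith
    rw [mul_assoc, abs_mul]
    have := Int.one_le_abs hX
    nlinarith

theorem hesse_none : ∀ (k : ℕ) (X Y Z : ℤ), IsCoprime X Y → IsCoprime Y Z → IsCoprime Z X →
    X ≠ 0 → Y ≠ 0 → Z ≠ 0 → X ^ 3 + Y ^ 3 + Z ^ 3 = 2 * (X * Y * Z) →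
    |X * Y * Z| < k → False := by
  intro k
  induction k with
  | zero =>
    intro X Y Z _ _ _ _ _ _ _ hk
    have := abs_nonneg (X * Y * Z)
    rw [Nat.cast_zero] at hk
    exact absurd hk (not_lt.mpr this)
  | succ k ih =>
    intro X Y Z c1 c2 c3 hX hY hZ h hk
    have p19 : Prime (19 : ℤ) := by
      rw [Int.prime_iff_natAbs_prime]; norm_num
    have h19 : (19 : ℤ) ∣ (2 * X + 3 * Y + 3 * Z) * (2 * Y + 3 * Z + 3 * X)
        * (2 * Z + 3 * X + 3 * Y) := by
      refine ⟨3 * (X ^ 2 * Y + X * Y ^ 2 + Y ^ 2 * Z + Y * Z ^ 2 + X ^ 2 * Z + X * Z ^ 2)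
        + 18 * 0 + 8 * X * Y * Z, ?_⟩
      linear_combination 18 * h
    have fin : (∃ a b c d : ℤ, d ≠ 0 ∧ a + b + c = 2 * d ∧ a * b * c = d ^ 3 ∧
        |d| < |X * Y * Z|) → False := by
      rintro ⟨a, b, c, d, hd, hs, hp, hlt⟩
      obtain ⟨X', Y', Z', d1, d2, d3, e1, e2, e3, h', hle⟩ := to_hesse a b c d hd hs hp
      refine ih X' Y' Z' d1 d2 d3 e1 e2 e3 h' ?_
      push_cast at hk
      omega
    apply fin
    rcases p19.dvd_or_dvd h19 with h1 | h1
    · rcases p19.dvd_or_dvd h1 with h2 | h2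
      · exact descent_step X Y Z c1 hX hY hZ h h2
      · rw [show X * Y * Z = Y * Z * X by ring]
        exact descent_step Y Z X c2 hY hZ hX (by linarith) h2
    · rw [show X * Y * Z = Z * X * Y by ring]
      exact descent_step Z X Y c3 hZ hX hY (by linarith) h1

theorem rat_none (A B C : ℚ) (hs : A + B + C = 2) (hp : A * B * C = 1) : False := by
  have hA : (A.den : ℚ) ≠ 0 := by exact_mod_cast A.den_nz
  have hB : (B.den : ℚ) ≠ 0 := by exact_mod_cast B.den_nz
  have hC : (C.den : ℚ) ≠ 0 := by exact_mod_cast C.den_nz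
  have eA : A * A.den = A.num := Rat.mul_den_eq_num A
  have eB : B * B.den = B.num := Rat.mul_den_eq_num B
  have eC : C * C.den = C.num := Rat.mul_den_eq_num C
  obtain ⟨X, Y, Z, c1, c2, c3, e1, e2, e3, h, -⟩ := to_hesse (A.num * B.den * C.den)
    (B.num * A.den * C.den) (C.num * A.den * B.den) (A.den * B.den * C.den)
    (by exact_mod_cast mul_ne_zero (mul_ne_zero hA hB) hC)
    (by
      have : (A.num * B.den * C.den + B.num * A.den * C.den + C.num * A.den * B.den : ℚ)
        = 2 * (A.den * B.den * C.den) := by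
        rw [← eA, ← eB, ← eC]; linear_combination (A.den * B.den * C.den : ℚ) * hs
      exact_mod_cast this)
    (by
      have : ((A.num * B.den * C.den) * (B.num * A.den * C.den) * (C.num * A.den * B.den) : ℚ)
        = (A.den * B.den * C.den) ^ 3 := by
        rw [← eA, ← eB, ← eC]; linear_combination (A.den * B.den * C.den : ℚ) ^ 3 * hp
      exact_mod_cast this)
  exact hesse_none ((|X * Y * Z|).toNat + 1) X Y Z c1 c2 c3 e1 e2 e3 h (by
    have := abs_nonneg (X * Y * Z)
    push_cast
    rw [Int.toNat_of_nonneg this]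
    omega)

/-- For `a ∉ {0, -1, -2}`, the first dynatomic cubic
`(a+1)X³ - (a+1)X² + aX + 1` does not split into linear factors over `ℚ`:
a quadratic rational map over `ℚ` with a rational critical 3-cycle has at
most one rational fixed point. -/
theorem stmt_2 (a : ℚ) (ha0 : a ≠ 0) (ha1 : a ≠ -1) (ha2 : a ≠ -2) :
    ¬ ∃ r s t : ℚ, ∀ X : ℚ,
      (a + 1) * X ^ 3 - (a + 1) * X ^ 2 + a * X + 1 =
        (a + 1) * (X - r) * (X - s) * (X - t) := by
  rintro ⟨r, s, t, h⟩
  have ha : a + 1 ≠ 0 := fun h' => ha1 (by linarith)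
  have h0 := h 0
  have h1 := h 1
  have h2 := h (-1)
  refine rat_none (1 - r) (1 - s) (1 - t) ?_ ?_
  · apply mul_left_cancel₀ ha
    linear_combination (-1 / 2) * h1 - (1 / 2) * h2 + h0
  · apply mul_left_cancel₀ ha
    linear_combination -h1
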